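/- Let r' be an integer with r·r' ≡ 1 (mod m). Then a nonnegative integer a is an arithmetic pure gap at the single index (0) (i.e., the 1-tuple (a) is an arithmetic pure gap at (0)) if and only if r·⌊a·r'/m⌋ + ⌊(−a·r·r')/m⌋ + ⌈a/m⌉ ≤ −1. -/

import Mathlib

open Finset

/-- Floor of the rational number `x / m`. -/
noncomputable def fdivq (m : ℕ) (x : ℤ) : ℤ := ⌊(x : ℚ) / (m : ℚ)⌋

/-- The quantity `∑_{i=0}^{n-1} ⌊(a_i + t·λ_{c i})/m⌋ + ∑_{w ∉ range c} ⌊t·λ_w/m⌋`. -/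
noncomputable def gapSum (m r n : ℕ) (lam : Fin (r + 1) → ℤ)
    (c : Fin n → Fin (r + 1)) (a : Fin n → ℤ) (t : ℤ) : ℤ :=
  (∑ i : Fin n, fdivq m (a i + t * lam (c i))) +
    ∑ w ∈ Finset.univ \ Finset.image c Finset.univ, fdivq m (t * lam w)

/-- `(a 0, …, a (n-1))` is an *arithmetic pure gap* at the (pairwise distinct) indices
`c 0, …, c (n-1)` of `{0,…,r}`: the entries are nonnegative and for every
`t ∈ {0,…,m-1}` exactly one of the two Bartoli–Quoos–Zini conditions holds. -/
noncomputable def IsArithPureGap (m r n : ℕ) (lam : Fin (r + 1) → ℤ)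
    (c : Fin n → Fin (r + 1)) (a : Fin n → ℤ) : Prop :=
  (∀ i, 0 ≤ a i) ∧
    ∀ t : ℤ, 0 ≤ t → t ≤ (m : ℤ) - 1 →
      Xor' (gapSum m r n lam c a t < 0)
        (0 ≤ gapSum m r n lam c a t ∧
          ∀ i : Fin n, fdivq m (a i + t * lam (c i)) = fdivq m (a i + t * lam (c i) - 1))

theorem fdivq_eq_ediv (m : ℕ) (x : ℤ) : fdivq m x = x / (m : ℤ) :=
  Rat.floor_intCast_div_natCast x m

theorem fdivq_add_mul {m : ℕ} (hm : 0 < m) (x k : ℤ) :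
    fdivq m (x + k * m) = fdivq m x + k := by
  rw [fdivq_eq_ediv, fdivq_eq_ediv, Int.add_mul_ediv_right _ _ (by omega)]

theorem ceil_div_eq_neg_fdivq_neg (m : ℕ) (a : ℤ) :
    ⌈(a : ℚ) / (m : ℚ)⌉ = -fdivq m (-a) := by
  rw [fdivq, Int.cast_neg, neg_div, Int.floor_neg, neg_neg]

theorem fdivq_eq_fdivq_sub_one_iff {m : ℕ} (hm : 2 ≤ m) (x : ℤ) :
    fdivq m x = fdivq m (x - 1) ↔ ¬ (m : ℤ) ∣ x := by
  have hm0 : (0 : ℤ) < m := by omega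
  rw [fdivq_eq_ediv, fdivq_eq_ediv]
  constructor
  · rintro h ⟨k, rfl⟩
    rw [Int.mul_ediv_cancel_left _ hm0.ne'] at h
    have := Int.mul_ediv_self_le (x := (m : ℤ) * k - 1) (k := (m : ℤ)) hm0.ne'
    have h2 := Int.lt_mul_ediv_self_add (x := (m : ℤ) * k - 1) (k := (m : ℤ)) hm0
    rw [← h] at this
    omega
  · intro h
    have hpos : 0 < x % m :=
      (Int.emod_nonneg x hm0.ne').lt_of_ne fun h0 => h (Int.dvd_of_emod_eq_zero h0.symm)
    have hlt := Int.emod_lt_of_pos x hm0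
    have hx := Int.emod_add_mul_ediv x m
    have hx' : x - 1 = (x % m - 1) + m * (x / m) := by linarith
    have hzero : (x % m - 1) / m = 0 := Int.ediv_eq_zero_of_lt (by omega) (by omega)
    rw [hx', Int.add_mul_ediv_left _ _ hm0.ne', hzero, zero_add]

theorem gapSum_infinite (m r : ℕ) (l : ℤ) (lam : Fin (r + 1) → ℤ)
    (hlam : ∀ i : Fin (r + 1), lam i = if i = 0 then -(r : ℤ) * l else l) (a t : ℤ) :
    gapSum m r 1 lam (fun _ => (0 : Fin (r + 1))) (fun _ => a) t =
      fdivq m (a - t * (r * l)) + r * fdivq m (t * l) := by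
  have himage : (Finset.univ : Finset (Fin 1)).image (fun _ => (0 : Fin (r + 1))) = {0} := by
    simp
  have hsum : ∑ w ∈ Finset.univ \ {(0 : Fin (r + 1))}, fdivq m (t * lam w) =
      r * fdivq m (t * l) := by
    rw [Finset.sum_congr rfl (g := fun _ => fdivq m (t * l)), Finset.sum_const,
      Finset.card_sdiff_of_subset (Finset.subset_univ _)]
    · simp
    · intro w hw
      rw [hlam, if_neg (by simpa using hw)]
  rw [gapSum, himage, hsum, hlam]
  simp [sub_eq_add_neg]

theorem gapSum_infinite_of_dvd {m r : ℕ} (hm : 0 < m) (l : ℤ) {r' : ℤ}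
    (hr' : Int.ModEq (m : ℤ) ((r : ℤ) * r') 1) {a t : ℤ} (ht : (m : ℤ) ∣ a - t * (r * l)) :
    fdivq m (a - t * (r * l)) + r * fdivq m (t * l) =
      r * fdivq m (a * r') + fdivq m (-(a * (r : ℤ) * r')) + ⌈(a : ℚ) / (m : ℚ)⌉ := by
  obtain ⟨u, hu⟩ := hr'.dvd
  obtain ⟨k, hk⟩ := ht
  have htl : a * r' = t * l + (k * r' - t * l * u) * m := by
    linear_combination r' * hk - t * l * hu
  have hneg : -(a * (r : ℤ) * r') = -a + (a * u) * m := by linear_combination a * hu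
  have hquot : a - t * (r * l) = 0 + k * m := by linear_combination hk
  have hzero : fdivq m 0 = 0 := by simp [fdivq]
  rw [ceil_div_eq_neg_fdivq_neg, htl, hneg, hquot, fdivq_add_mul hm, fdivq_add_mul hm,
    fdivq_add_mul hm, hzero]
  have hcancel : (m : ℤ) * k = m * (r * (k * r' - t * l * u) + a * u) := by
    linear_combination -hk + r * htl + a * hu
  have := mul_left_cancel₀ (by omega : (m : ℤ) ≠ 0) hcancel
  linarith

theorem exists_dvd_sub_mul {m : ℕ} (hm : 0 < m) {n : ℤ} (hn : Int.gcd (m : ℤ) n = 1) (a : ℤ) :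
    ∃ t : ℤ, 0 ≤ t ∧ t ≤ (m : ℤ) - 1 ∧ (m : ℤ) ∣ a - t * n := by
  have hm0 : (0 : ℤ) < m := by omega
  obtain ⟨u, v, huv⟩ := Int.isCoprime_iff_gcd_eq_one.mpr hn
  refine ⟨(a * v) % m, Int.emod_nonneg _ hm0.ne', ?_, ?_⟩
  · have := Int.emod_lt_of_pos (a * v) hm0
    omega
  · refine ⟨a * u + (a * v / m) * n, ?_⟩
    linear_combination -a * huv - n * Int.emod_add_mul_ediv (a * v) m

/-- For `λ_1 = ⋯ = λ_r = λ`, `λ_0 = −rλ`, `gcd(m, rλ) = 1`, and `r·r' ≡ 1 (mod m)`: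
a nonnegative integer `a` is a gap at the infinite index `0` iff
`r·⌊a·r'/m⌋ + ⌊(−a·r·r')/m⌋ + ⌈a/m⌉ ≤ −1`. -/
theorem infinite_gap_iff_equal_multiplicities (m r : ℕ) (hm : 2 ≤ m) (hr : 1 ≤ r)
    (l : ℤ) (hl : l ≠ 0) (hgcd : Int.gcd (m : ℤ) ((r : ℤ) * l) = 1)
    (lam : Fin (r + 1) → ℤ)
    (hlam : ∀ i : Fin (r + 1), lam i = if i = 0 then -(r : ℤ) * l else l)
    (r' : ℤ) (hr' : Int.ModEq (m : ℤ) ((r : ℤ) * r') 1)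
    (a : ℤ) (ha : 0 ≤ a) :
    IsArithPureGap m r 1 lam (fun _ => (0 : Fin (r + 1))) (fun _ => a) ↔
      (r : ℤ) * fdivq m (a * r') + fdivq m (-(a * (r : ℤ) * r')) + ⌈(a : ℚ) / (m : ℚ)⌉ ≤ -1 := by
  have hm0 : 0 < m := by omega
  have hxor (p : ℤ) (q : Prop) : Xor (p < 0) (0 ≤ p ∧ q) ↔ (¬ q → p < 0) := by
    by_cases hp : p < 0
    · simp [hp, Xor]
    · simp [hp, Xor, not_lt.mp hp]
  have hlam0 : lam 0 = -((r : ℤ) * l) := by simp [hlam]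
  simp only [IsArithPureGap, gapSum_infinite m r l lam hlam, hlam0, forall_const,
    fdivq_eq_fdivq_sub_one_iff hm, mul_neg, ← sub_eq_add_neg]
  constructor
  · rintro ⟨-, h⟩
    obtain ⟨t, ht0, htm, ht⟩ := exists_dvd_sub_mul hm0 hgcd a
    have := (hxor _ _).mp (h t ht0 htm) (not_not.mpr ht)
    rw [gapSum_infinite_of_dvd hm0 l hr' ht] at this
    omega
  · refine fun h => ⟨ha, fun t _ _ => (hxor _ _).mpr fun ht => ?_⟩
    rw [gapSum_infinite_of_dvd hm0 l hr' (not_not.mp ht)]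
    omega
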